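/- Let 𝒜 be a complex Banach algebra with identity I, let ℳ be a Banach left 𝒜-module, and let δ : 𝒜 → ℳ be a linear map for which there exists ξ ∈ ℳ such that δ(AB) = Aδ(B) + Bδ(A) − (AB)ξ for all A, B ∈ 𝒜. Then δ is a left derivation if and only if I·δ(I) = 0. -/

import Mathlib

/-- For a generalized left derivation `δ` (with `ξ ∈ ℳ`) on a unital Banach
algebra, `δ` is a left derivation iff `1 • δ(1) = 0`. -/
theorem stmt_10
    {A : Type*} [NormedRing A] [NormedAlgebra ℂ A] [CompleteSpace A]
    {M : Type*} [NormedAddCommGroup M] [NormedSpace ℂ M] [CompleteSpace M]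
    [Module A M] [IsScalarTower ℂ A M]
    (hact : Continuous fun p : A × M => p.1 • p.2)
    (δ : A →ₗ[ℂ] M) (ξ : M)
    (hξ : ∀ a b : A, δ (a * b) = a • δ b + b • δ a - (a * b) • ξ) :
    (∀ a b : A, δ (a * b) = a • δ b + b • δ a) ↔ (1 : A) • δ 1 = 0 := by
  have hδξ : δ 1 = ξ := by
    have h := hξ 1 1
    simp only [mul_one, one_smul] at h
    rw [add_sub_assoc, left_eq_add, sub_eq_zero] at h
    exact h
  rw [one_smul, hδξ]
  constructor
  · intro h
    have h1 := h 1 1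
    rwa [mul_one, one_smul, left_eq_add, hδξ] at h1
  · rintro rfl a b
    rw [hξ, smul_zero, sub_zero]
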